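/- Under the standing assumptions, and with E_0 a constant as specified, there exists L_1 > 0 such that for every natural number L > L_1 and every ε > 0 there exists R_1 > 0 with the following property for all sufficiently large n. Define K_1(n) := ∪_{⌈εn⌉ ≤ r ≤ n/2} { a·b·c·a^{-1} : a ∈ B_S(r), b ∈ B_S(n − 2r + 2R_1), c ∈ B_S(2R_1) } and K_2(n) := ∪_{r,r' ≥ 0, r+r' ≤ (1−ε)n} { a·c·b·a^{-1} : a ∈ B_S(r + 2R_1), b ∈ B_S(r' + 2R_1), c ∈ B_S(2R_1) }, and K^{-1} := {g^{-1} : g ∈ K}. Then V_{L,3ε}(n) \ (K_1(n) ∪ K_2(n) ∪ K_1(n)^{-1} ∪ K_2(n)^{-1}) ⊆ W_{L,ε}(n). -/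

import Mathlib

namespace AcylCount

/-! ### Geodesic segments and Gromov hyperbolicity -/

/-- A finite geodesic segment in a metric space, parametrized by arclength on `[0, len]`,
oriented from `initial := toFun 0` to `terminal := toFun len`. -/
structure GeodesicSegment (X : Type*) [MetricSpace X] where
  len : ℝ
  len_nonneg : 0 ≤ len
  toFun : ℝ → X
  isom : ∀ s ∈ Set.Icc (0:ℝ) len, ∀ t ∈ Set.Icc (0:ℝ) len,
    dist (toFun s) (toFun t) = |s - t|

namespace GeodesicSegment

variable {X : Type*} [MetricSpace X]

/-- The initial point of a geodesic segment. -/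
def initial (γ : GeodesicSegment X) : X := γ.toFun 0

/-- The terminal point of a geodesic segment. -/
def terminal (γ : GeodesicSegment X) : X := γ.toFun γ.len

/-- The image (underlying set) of a geodesic segment. -/
def seg (γ : GeodesicSegment X) : Set X := γ.toFun '' Set.Icc 0 γ.len

/-- The translate of a geodesic segment by an isometry. -/
def translate (γ : GeodesicSegment X) (f : X → X) (hf : Isometry f) :
    GeodesicSegment X where
  len := γ.len
  len_nonneg := γ.len_nonneg
  toFun := f ∘ γ.toFun
  isom := fun s hs t ht => by
    simp only [Function.comp_apply, hf.dist_eq]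
    exact γ.isom s hs t ht

/-- The degenerate geodesic segment consisting of a single point. -/
def point (p : X) : GeodesicSegment X where
  len := 0
  len_nonneg := le_refl 0
  toFun := fun _ => p
  isom := fun s hs t ht => by
    have hs0 : s = 0 := le_antisymm hs.2 hs.1
    have ht0 : t = 0 := le_antisymm ht.2 ht.1
    simp [hs0, ht0]

/-- `η` is a subsegment of `γ`. -/
def IsSubsegment (η γ : GeodesicSegment X) : Prop :=
  ∃ a b : ℝ, 0 ≤ a ∧ a ≤ b ∧ b ≤ γ.len ∧ η.len = b - a ∧
    ∀ t ∈ Set.Icc (0:ℝ) η.len, η.toFun t = γ.toFun (a + t)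

/-- `p` occurs (weakly) before `q` along the oriented geodesic segment `γ`. -/
def Before (γ : GeodesicSegment X) (p q : X) : Prop :=
  ∃ s t : ℝ, s ∈ Set.Icc (0:ℝ) γ.len ∧ t ∈ Set.Icc (0:ℝ) γ.len ∧ s ≤ t ∧
    γ.toFun s = p ∧ γ.toFun t = q

end GeodesicSegment

/-- A geodesic metric space: every two points are joined by a geodesic segment. -/
def IsGeodesicSpace (X : Type*) [MetricSpace X] : Prop :=
  ∀ x y : X, ∃ γ : GeodesicSegment X, γ.initial = x ∧ γ.terminal = y

/-- δ-hyperbolicity via slim triangles: each side of a geodesic triangle lies in the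
closed δ-neighborhood of the union of the other two sides. -/
def IsDeltaHyperbolic (X : Type*) [MetricSpace X] (δ : ℝ) : Prop :=
  ∀ γ₁ γ₂ γ₃ : GeodesicSegment X,
    γ₁.initial = γ₃.initial → γ₁.terminal = γ₂.initial → γ₂.terminal = γ₃.terminal →
    γ₃.seg ⊆ Metric.cthickening δ (γ₁.seg ∪ γ₂.seg)

variable {X : Type*} [MetricSpace X]

/-- The closest point projection of `x` to (the image of) the geodesic `γ`. -/
def proj (γ : GeodesicSegment X) (x : X) : Set X :=
  {p | p ∈ γ.seg ∧ dist x p = Metric.infDist x γ.seg}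

/-- The closest point projection of a set `A` to the geodesic `γ`. -/
def projSet (γ : GeodesicSegment X) (A : Set X) : Set X :=
  ⋃ a ∈ A, proj γ a

/-- The ordered pair of oriented geodesic segments `(γ, η)` is `K`-aligned. -/
def AlignedPair (K : ℝ) (γ η : GeodesicSegment X) : Prop :=
  Metric.diam (projSet γ η.seg ∪ {γ.terminal}) < K ∧
  Metric.diam (projSet η γ.seg ∪ {η.initial}) < K

/-- A sequence of oriented geodesic segments is `K`-aligned if each consecutive
pair is `K`-aligned. -/
def AlignedSeq (K : ℝ) (l : List (GeodesicSegment X)) : Prop :=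
  l.Chain' (AlignedPair K)

/-- The Gromov product `(y, z)_x`. -/
noncomputable def gromovProd (x y z : X) : ℝ := (dist y x + dist x z - dist y z) / 2

/-! ### Word metric -/

variable {G : Type*} [Group G]

/-- The word length of `g` with respect to the (symmetrized) generating set `S`. -/
noncomputable def wordLength (S : Finset G) (g : G) : ℕ :=
  sInf {n | ∃ l : List G, l.length = n ∧ (∀ x ∈ l, x ∈ S ∨ x⁻¹ ∈ S) ∧ l.prod = g}

/-- The word metric on `G` with respect to `S`. -/
noncomputable def wordDist (S : Finset G) (g h : G) : ℕ := wordLength S (g⁻¹ * h)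

/-- The ball of radius `r` in the word metric, centered at the identity. -/
def ball (S : Finset G) (r : ℝ) : Set G := {g | (wordLength S g : ℝ) ≤ r}

/-- `G` has no cyclic subgroup of finite index. -/
def NonVirtuallyCyclic (G : Type*) [Group G] : Prop :=
  ¬ ∃ H : Subgroup G, H.FiniteIndex ∧ IsCyclic H

/-! ### Isometric actions, loxodromics, WPD -/

/-- `g` is a loxodromic isometry for the action `ρ` with basepoint `x0`: the asymptotic
translation length `τ_X(g) = lim dist x0 (g^n x0) / n` exists and is positive. -/
def IsLoxodromic (ρ : G → X → X) (x0 : X) (g : G) : Prop :=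
  ∃ τ : ℝ, 0 < τ ∧
    Filter.Tendsto (fun n : ℕ => dist x0 (ρ (g ^ n) x0) / n) Filter.atTop (nhds τ)

/-- The WPD (weak proper discontinuity) property of `g` for the action `ρ` with
basepoint `x0`. -/
def HasWPD (ρ : G → X → X) (x0 : X) (g : G) : Prop :=
  ∀ K : ℝ, 0 < K → ∃ N M : ℕ,
    {h : G | dist x0 (ρ h x0) < K ∧ dist (ρ (g ^ N) x0) (ρ h (ρ (g ^ N) x0)) < K}.Finite ∧
    {h : G | dist x0 (ρ h x0) < K ∧ dist (ρ (g ^ N) x0) (ρ h (ρ (g ^ N) x0)) < K}.ncard < M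

/-- The list of translated geodesics `h 1 • Υ, …, h m • Υ`. -/
def transList (ρ : G → X → X) (hisom : ∀ g : G, Isometry (ρ g))
    (Υ : GeodesicSegment X) (h : ℕ → G) (m : ℕ) : List (GeodesicSegment X) :=
  (List.range m).map fun i => Υ.translate (ρ (h (i + 1))) (hisom _)

/-- The specification of the constant `E₀` from Fact 2.7 (Bestvina–Fujiwara):
(i) Gromov product bounds, (ii) the WPD-type conclusion for large projections. -/
def E0Spec (S : Finset G) (ρ : G → X → X) (x0 : X) (φ : G) (E0 : ℝ) : Prop :=
  0 < E0 ∧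
  (∀ g : G, ∃ s t : G, (s ∈ S ∨ s = 1) ∧ (t ∈ S ∨ t = 1) ∧
    (∀ i : ℤ, 0 < i → gromovProd x0 (ρ (φ ^ i) x0) (ρ (s * g) x0) ≤ E0) ∧
    (∀ j : ℤ, j < 0 → gromovProd x0 (ρ (φ ^ j) x0) (ρ (t * g) x0) ≤ E0)) ∧
  (∀ n : ℕ, 0 < n → ∀ g : G, ∀ γ : GeodesicSegment X,
    γ.initial = x0 → γ.terminal = ρ (φ ^ n) x0 →
    ∀ p ∈ proj γ (ρ g x0), ∀ q ∈ proj γ (ρ (g * φ ^ n) x0),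
      γ.Before p q → E0 < dist p q →
      ∃ i j : ℕ, i ≤ n ∧ j ≤ n ∧ (wordDist S (φ ^ i) (g * φ ^ j) : ℝ) < E0)

/-- The set `V_{L,ε}(n)`. Here `Υ` is the chosen geodesic `Υ_L = [x₀, φ^L x₀]`. -/
def Vset (S : Finset G) (ρ : G → X → X) (hisom : ∀ g : G, Isometry (ρ g)) (x0 : X)
    (δ E0 : ℝ) (Υ : GeodesicSegment X) (ε : ℝ) (n : ℕ) : Set G :=
  {g | g ∈ ball S (n:ℝ) ∧ ∃ h : ℕ → G,
    AlignedSeq (6 * E0 + 300 * δ)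
      ([GeodesicSegment.point x0] ++ transList ρ hisom Υ h ⌈ε * (n:ℝ)⌉₊ ++
        [GeodesicSegment.point (ρ g x0)])}

/-- The set `W_{L,ε}(n)`. Here `Υ` is the chosen geodesic `Υ_L = [x₀, φ^L x₀]`. -/
def Wset (S : Finset G) (ρ : G → X → X) (hisom : ∀ g : G, Isometry (ρ g)) (x0 : X)
    (δ E0 : ℝ) (Υ : GeodesicSegment X) (ε : ℝ) (n : ℕ) : Set G :=
  {g | g ∈ ball S (n:ℝ) ∧ ∃ h : ℕ → G,
    AlignedSeq (6 * E0 + 360 * δ)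
      ([GeodesicSegment.point x0] ++ transList ρ hisom Υ h ⌈ε * (n:ℝ)⌉₊ ++
        [GeodesicSegment.point (ρ g x0)]) ∧
    AlignedPair (6 * E0 + 360 * δ) (GeodesicSegment.point (ρ g⁻¹ x0))
      (Υ.translate (ρ (h 1)) (hisom _)) ∧
    AlignedPair (6 * E0 + 360 * δ) (Υ.translate (ρ (h ⌈ε * (n:ℝ)⌉₊)) (hisom _))
      (GeodesicSegment.point (ρ (g ^ 2) x0))}

/-- The set `BAD_{L,ε}(n)`. -/
def BADset (S : Finset G) (ρ : G → X → X) (hisom : ∀ g : G, Isometry (ρ g)) (x0 : X)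
    (δ E0 : ℝ) (Υ : GeodesicSegment X) (ε : ℝ) (n : ℕ) : Set G :=
  ball S (n:ℝ) \ (ball S ((⌊(0.9:ℝ) * (n:ℝ)⌋₊ : ℕ) : ℝ) ∪ Vset S ρ hisom x0 δ E0 Υ ε n)

/-! ### Paths in the word metric -/

/-- `P` is a `d_S`-path connecting `a` to `b`. -/
noncomputable def IsPathFrom (S : Finset G) (P : List G) (a b : G) : Prop :=
  P ≠ [] ∧ P.Chain' (fun u v => wordDist S u v = 1) ∧ P.head? = some a ∧ P.getLast? = some b

/-- The distance `d_S(P, g)` from a path `P` to a group element `g`. -/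
noncomputable def pathDist (S : Finset G) (P : List G) (g : G) : ℕ :=
  sInf {d | ∃ v ∈ P, d = wordDist S v g}


/-- The conjugacy-type exceptional set `K₁` from the proof of Lemma 4.6. -/
def K1set {G : Type*} [Group G] (S : Finset G) (ε R1 : ℝ) (n : ℕ) : Set G :=
  {x | ∃ r : ℕ, ⌈ε * (n:ℝ)⌉₊ ≤ r ∧ (r : ℝ) ≤ (n : ℝ) / 2 ∧ ∃ a b c : G,
    a ∈ ball S (r : ℝ) ∧ b ∈ ball S ((n : ℝ) - 2 * (r : ℝ) + 2 * R1) ∧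
    c ∈ ball S (2 * R1) ∧ x = a * b * c * a⁻¹}

/-- The conjugacy-type exceptional set `K₂` from the proof of Lemma 4.6. -/
def K2set {G : Type*} [Group G] (S : Finset G) (ε R1 : ℝ) (n : ℕ) : Set G :=
  {x | ∃ r r' : ℕ, (r : ℝ) + (r' : ℝ) ≤ (1 - ε) * (n : ℝ) ∧ ∃ a b c : G,
    a ∈ ball S ((r : ℝ) + 2 * R1) ∧ b ∈ ball S ((r' : ℝ) + 2 * R1) ∧
    c ∈ ball S (2 * R1) ∧ x = a * c * b * a⁻¹}

section WordMetric

variable {G : Type*} [Group G] {S : Finset G}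

theorem wordLength_le_of_list {l : List G} (hl : ∀ x ∈ l, x ∈ S ∨ x⁻¹ ∈ S) :
    wordLength S l.prod ≤ l.length :=
  Nat.sInf_le ⟨l, rfl, hl, rfl⟩

theorem exists_list_length_eq_wordLength (hS : Subgroup.closure (S : Set G) = ⊤) (g : G) :
    ∃ l : List G, l.length = wordLength S g ∧ (∀ x ∈ l, x ∈ S ∨ x⁻¹ ∈ S) ∧ l.prod = g := by
  have hg : g ∈ (Subgroup.closure (S : Set G)).toSubmonoid := by simp [hS]
  rw [Subgroup.closure_toSubmonoid] at hg
  obtain ⟨l, hl, hlg⟩ := Submonoid.exists_list_of_mem_closure hg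
  exact Nat.sInf_mem
    (s := {n | ∃ l : List G, l.length = n ∧ (∀ x ∈ l, x ∈ S ∨ x⁻¹ ∈ S) ∧ l.prod = g})
    ⟨l.length, l, rfl, by simpa using hl, hlg⟩

theorem wordLength_one : wordLength S (1 : G) = 0 := by
  simpa using wordLength_le_of_list (S := S) (l := []) (by simp)

theorem wordLength_mul_le (hS : Subgroup.closure (S : Set G) = ⊤) (g h : G) :
    wordLength S (g * h) ≤ wordLength S g + wordLength S h := by
  obtain ⟨l, hl, hlS, rfl⟩ := exists_list_length_eq_wordLength hS g
  obtain ⟨k, hk, hkS, rfl⟩ := exists_list_length_eq_wordLength hS h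
  rw [← hl, ← hk, ← List.prod_append, ← List.length_append]
  refine wordLength_le_of_list fun x hx => ?_
  rcases List.mem_append.1 hx with hx | hx
  exacts [hlS x hx, hkS x hx]

theorem wordLength_inv_le (hS : Subgroup.closure (S : Set G) = ⊤) (g : G) :
    wordLength S g⁻¹ ≤ wordLength S g := by
  obtain ⟨l, hl, hlS, rfl⟩ := exists_list_length_eq_wordLength hS g
  rw [← hl, List.prod_inv_reverse]
  refine (wordLength_le_of_list fun x hx => ?_).trans (by simp)
  simp only [List.mem_reverse, List.mem_map] at hx
  obtain ⟨y, hy, rfl⟩ := hx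
  simpa using (hlS y hy).symm

theorem wordLength_inv (hS : Subgroup.closure (S : Set G) = ⊤) (g : G) :
    wordLength S g⁻¹ = wordLength S g :=
  le_antisymm (wordLength_inv_le hS g) (by simpa using wordLength_inv_le hS g⁻¹)

theorem wordLength_pow_le (hS : Subgroup.closure (S : Set G) = ⊤) (g : G) (n : ℕ) :
    wordLength S (g ^ n) ≤ n * wordLength S g := by
  induction n with
  | zero => simp [wordLength_one]
  | succ n ih =>
    rw [pow_succ, add_one_mul]
    exact (wordLength_mul_le hS _ _).trans (by omega)

/-- Every element is reached from the identity by a geodesic path in the word metric. -/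
theorem exists_wordGeodesic (hS : Subgroup.closure (S : Set G) = ⊤) (g : G) :
    ∃ q : ℕ → G, q 0 = 1 ∧ q (wordLength S g) = g ∧
      ∀ s t, s ≤ t → wordLength S ((q s)⁻¹ * q t) ≤ t - s := by
  obtain ⟨l, hl, hlS, rfl⟩ := exists_list_length_eq_wordLength hS g
  refine ⟨fun t => (l.take t).prod, by simp, by simp [← hl], fun s t hst => ?_⟩
  have h : l.take t = l.take s ++ (l.drop s).take (t - s) := by
    rw [← List.take_add, Nat.add_sub_cancel' hst]
  simp only [h, List.prod_append, inv_mul_cancel_left]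
  refine (wordLength_le_of_list fun x hx => ?_).trans (List.length_take_le _ _)
  exact hlS x (List.mem_of_mem_drop (List.mem_of_mem_take hx))

theorem finite_setOf_wordLength_le (hS : Subgroup.closure (S : Set G) = ⊤) (R : ℕ) :
    {g : G | wordLength S g ≤ R}.Finite := by
  have key : ∀ n : ℕ, {g : G | ∃ l : List G, l.length = n ∧
      (∀ x ∈ l, x ∈ S ∨ x⁻¹ ∈ S) ∧ l.prod = g}.Finite := by
    intro n
    induction n with
    | zero =>
      refine (Set.finite_singleton (1 : G)).subset ?_
      rintro g ⟨l, hl, -, rfl⟩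
      simp [List.length_eq_zero_iff.1 hl]
    | succ n ih =>
      have hfin : ((S : Set G) ∪ (S : Set G)⁻¹).Finite :=
        S.finite_toSet.union S.finite_toSet.inv
      refine (hfin.image2 (· * ·) ih).subset ?_
      rintro g ⟨l, hl, hlS, rfl⟩
      obtain ⟨a, k, rfl⟩ := List.exists_cons_of_length_eq_add_one hl
      exact ⟨a, by simpa using hlS a (by simp), k.prod,
        ⟨k, by simpa using hl, fun x hx => hlS x (by simp [hx]), rfl⟩, by simp⟩
  refine ((Set.finite_le_nat R).biUnion fun n _ => key n).subset fun g hg => ?_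
  exact Set.mem_biUnion (show wordLength S g ∈ {i | i ≤ R} from hg)
    (exists_list_length_eq_wordLength hS g)

end WordMetric

section Crossing

/-- Between a time at which `A` holds and a later one at which `C` holds, there is an
interval going from `A` to `C` on whose interior neither holds. -/
theorem exists_crossing {A C : ℕ → Prop} {a b : ℕ} (hab : a ≤ b) (ha : A a) (hb : C b)
    (hAC : ∀ r, A r → ¬ C r) :
    ∃ s t, a ≤ s ∧ s < t ∧ t ≤ b ∧ A s ∧ C t ∧ ∀ r, s < r → r < t → ¬ A r ∧ ¬ C r := by
  classical
  have hex : ∃ t, a ≤ t ∧ C t := ⟨b, hab, hb⟩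
  obtain ⟨hat, hCt⟩ := Nat.find_spec hex
  have hs : A (Nat.findGreatest A (Nat.find hex)) := Nat.findGreatest_spec hat ha
  refine ⟨Nat.findGreatest A (Nat.find hex), Nat.find hex, Nat.le_findGreatest hat ha,
    lt_of_le_of_ne (Nat.findGreatest_le _) fun h => hAC _ (h ▸ hs) hCt,
    Nat.find_min' hex ⟨hab, hb⟩, hs, hCt, fun r hr hrt => ⟨?_, fun hC => ?_⟩⟩
  · exact Nat.findGreatest_is_greatest hr hrt.le
  · exact Nat.find_min hex hrt ⟨(Nat.le_findGreatest hat ha).trans hr.le, hC⟩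

open Classical in
/-- The times in `[a, b]` at which the path `q` is strictly inside the `i`-th region. -/
noncomputable def insideTimes {α : Type*} (St En : ℕ → α → Prop) (q : ℕ → α) (a b i : ℕ) :
    Finset ℕ :=
  (Finset.Icc a b).filter fun r => ¬ St i (q r) ∧ ¬ En i (q r)

theorem sum_card_insideTimes_le {α : Type*} {St En : ℕ → α → Prop} {M : ℕ}
    (hb : ∀ i j, 1 ≤ i → i < j → j ≤ M → ∀ u, St j u ∨ En i u)
    (q : ℕ → α) (a b : ℕ) (I : Finset ℕ) (hI : I ⊆ Finset.Icc 1 M) :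
    ∑ i ∈ I, (insideTimes St En q a b i).card ≤ b + 1 - a := by
  classical
  rw [← Finset.card_biUnion, ← Nat.card_Icc]
  · exact Finset.card_le_card (Finset.biUnion_subset.2 fun i _ => Finset.filter_subset _ _)
  · intro i hi j hj hij
    have hi' := Finset.mem_Icc.1 (hI hi)
    have hj' := Finset.mem_Icc.1 (hI hj)
    rw [Function.onFun, Finset.disjoint_left]
    intro r hri hrj
    have h1 := (Finset.mem_filter.1 hri).2
    have h2 := (Finset.mem_filter.1 hrj).2
    rcases lt_or_gt_of_ne hij with h | h
    · exact (hb i j hi'.1 h hj'.2 (q r)).elim h2.1 h1.2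
    · exact (hb j i hj'.1 h hi'.2 (q r)).elim h1.1 h2.2

variable {G : Type*} [Group G] {S : Finset G} {St En : ℕ → G → Prop} {M : ℕ}

theorem exists_crossing_insideTimes
    (hc : ∀ i, 1 ≤ i → i ≤ M → ∀ u v, St i u → En i v → 4 ≤ wordLength S (u⁻¹ * v))
    {q : ℕ → G} {a b : ℕ} (hab : a ≤ b)
    (hq : ∀ s t, s ≤ t → t ≤ b → wordLength S ((q s)⁻¹ * q t) ≤ t - s)
    {i : ℕ} (hi : 1 ≤ i) (hiM : i ≤ M) (ha : St i (q a)) (hb : En i (q b)) :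
    ∃ s t, a ≤ s ∧ s + 4 ≤ t ∧ t ≤ b ∧ St i (q s) ∧ En i (q t) ∧
      (∀ r, s < r → r < t → ¬ St i (q r) ∧ ¬ En i (q r)) ∧
      t ≤ s + 1 + (insideTimes St En q a b i).card := by
  classical
  obtain ⟨s, t, has, hst, htb, hs, ht, hr⟩ := exists_crossing (A := fun r => St i (q r))
    (C := fun r => En i (q r)) hab ha hb fun r h1 h2 => by
      have := hc i hi hiM _ _ h1 h2
      simp [wordLength_one] at this
  refine ⟨s, t, has, ?_, htb, hs, ht, hr, ?_⟩
  · have := hc i hi hiM _ _ hs ht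
    have := hq s t hst.le htb
    omega
  · have hsub : Finset.Ioo s t ⊆ insideTimes St En q a b i := by
      intro r hrm
      have hrm' := Finset.mem_Ioo.1 hrm
      exact Finset.mem_filter.2 ⟨Finset.mem_Icc.2 ⟨by omega, by omega⟩, hr r hrm'.1 hrm'.2⟩
    have := Finset.card_le_card hsub
    rw [Nat.card_Ioo] at this
    omega

theorem three_mul_card_le
    (hb : ∀ i j, 1 ≤ i → i < j → j ≤ M → ∀ u, St j u ∨ En i u)
    (hc : ∀ i, 1 ≤ i → i ≤ M → ∀ u v, St i u → En i v → 4 ≤ wordLength S (u⁻¹ * v))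
    {q : ℕ → G} {a b : ℕ} (hab : a ≤ b)
    (hq : ∀ s t, s ≤ t → t ≤ b → wordLength S ((q s)⁻¹ * q t) ≤ t - s)
    (I : Finset ℕ) (hI : I ⊆ Finset.Icc 1 M)
    (hIst : ∀ i ∈ I, St i (q a)) (hIen : ∀ i ∈ I, En i (q b)) :
    3 * I.card ≤ b + 1 - a := by
  refine le_trans ?_ (sum_card_insideTimes_le hb q a b I hI)
  rw [mul_comm, ← smul_eq_mul]
  refine Finset.card_nsmul_le_sum _ _ _ fun i hi => ?_
  have hi' := Finset.mem_Icc.1 (hI hi)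
  obtain ⟨s, t, -, hst, -, -, -, -, hle⟩ :=
    exists_crossing_insideTimes hc hab hq hi'.1 hi'.2 (hIst i hi) (hIen i hi)
  omega

/-- A path crossing all the regions crosses the `i`-th one at a time which is controlled by
the number of regions before and after it. -/
theorem exists_crossing_bounds
    (hb : ∀ i j, 1 ≤ i → i < j → j ≤ M → ∀ u, St j u ∨ En i u)
    (hc : ∀ i, 1 ≤ i → i ≤ M → ∀ u v, St i u → En i v → 4 ≤ wordLength S (u⁻¹ * v))
    {q : ℕ → G} {N : ℕ}
    (hq : ∀ s t, s ≤ t → t ≤ N → wordLength S ((q s)⁻¹ * q t) ≤ t - s)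
    (h0 : ∀ i, 1 ≤ i → i ≤ M → St i (q 0)) {i : ℕ} (hi : 1 ≤ i) (hiM : i ≤ M)
    (hN : En i (q N)) :
    ∃ s t, s ≤ t ∧ t ≤ N ∧ St i (q s) ∧ En i (q t) ∧
      t ≤ s + 1 + (insideTimes St En q 0 N i).card ∧ 3 * (i - 1) ≤ s + 2 ∧
      ((∀ j, i < j → j ≤ M → En j (q N)) → 3 * (M - i) ≤ N - s) := by
  obtain ⟨s, t, -, hst, htN, hs, ht, hr, hle⟩ :=
    exists_crossing_insideTimes hc N.zero_le hq hi hiM (h0 i hi hiM) hN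
  obtain ⟨hrs, hre⟩ := hr (s + 1) (by omega) (by omega)
  refine ⟨s, t, by omega, htN, hs, ht, hle, ?_, fun hen => ?_⟩
  · have := three_mul_card_le hb hc (Nat.zero_le (s + 1))
      (fun x y hxy hy => hq x y hxy (by omega)) (Finset.Ico 1 i)
      (fun j hj => by rw [Finset.mem_Ico] at hj; rw [Finset.mem_Icc]; omega)
      (fun j hj => by rw [Finset.mem_Ico] at hj; exact h0 j hj.1 (by omega))
      (fun j hj => by
        rw [Finset.mem_Ico] at hj
        exact (hb j i hj.1 hj.2 hiM _).resolve_left hrs)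
    rw [Nat.card_Ico] at this
    omega
  · have := three_mul_card_le hb hc (show s + 1 ≤ N by omega) hq (Finset.Ioc i M)
      (fun j hj => by rw [Finset.mem_Ioc] at hj; rw [Finset.mem_Icc]; omega)
      (fun j hj => by
        rw [Finset.mem_Ioc] at hj
        exact (hb i j hi hj.1 hj.2 _).resolve_right hre)
      (fun j hj => by rw [Finset.mem_Ioc] at hj; exact hen j hj.1 hj.2)
    rw [Nat.card_Ioc] at this
    omega

/-- The exceptional set `K₁ ∪ K₂ ∪ K₁⁻¹ ∪ K₂⁻¹`. -/
def exceptionalSet (S : Finset G) (ε R1 : ℝ) (n : ℕ) : Set G :=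
  K1set S ε R1 n ∪ K2set S ε R1 n ∪ (K1set S ε R1 n)⁻¹ ∪ (K2set S ε R1 n)⁻¹

theorem inv_mem_exceptionalSet {ε R1 : ℝ} {n : ℕ} {g : G} (h : g⁻¹ ∈ exceptionalSet S ε R1 n) :
    g ∈ exceptionalSet S ε R1 n := by
  simp only [exceptionalSet, Set.mem_union, Set.mem_inv, inv_inv] at h ⊢
  tauto

/-- If a word geodesic to `g` and one to `g⁻¹` come close to each other at the times `s` and
`s'`, then `g` is exceptional. -/
theorem mem_exceptionalSet_of_close (hS : Subgroup.closure (S : Set G) = ⊤)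
    {ε R1 : ℝ} (hR1 : 0 ≤ R1) {n N s s' R3 : ℕ} (hNn : N ≤ n) (hR3 : (R3 : ℝ) ≤ 2 * R1) {g : G}
    {q : ℕ → G} (hq0 : q 0 = 1)
    (hq : ∀ s t, s ≤ t → wordLength S ((q s)⁻¹ * q t) ≤ t - s) (hqN : q N = g)
    (hs'N : s' ≤ N) (hs : ⌈ε * (n : ℝ)⌉₊ ≤ s) (hs' : ⌈ε * (n : ℝ)⌉₊ ≤ s')
    (hsN : s + ⌈ε * (n : ℝ)⌉₊ ≤ N)
    (hclose : wordLength S ((q s)⁻¹ * (g⁻¹ * q (N - s'))) ≤ R3) :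
    g ∈ exceptionalSet S ε R1 n := by
  have hnorm : ∀ t, wordLength S (q t) ≤ t := fun t => by
    simpa [hq0] using hq 0 t (Nat.zero_le t)
  set e := (q s)⁻¹ * (g⁻¹ * q (N - s')) with he
  have hge : g = q (N - s') * e⁻¹ * (q s)⁻¹ := by rw [he]; group
  have heR : (wordLength S e : ℝ) ≤ 2 * R1 := le_trans (by exact_mod_cast hclose) hR3
  have heR' : (wordLength S e⁻¹ : ℝ) ≤ 2 * R1 := by rwa [wordLength_inv hS]
  have hNn' : (N : ℝ) ≤ n := by exact_mod_cast hNn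
  rcases le_or_gt (s + s') N with h | h
  · have hbl : wordLength S ((q s)⁻¹ * q (N - s')) ≤ N - s' - s := hq _ _ (by omega)
    have hbl' : (wordLength S ((q s)⁻¹ * q (N - s')) : ℝ) + s + s' ≤ N := by
      exact_mod_cast (by omega : wordLength S ((q s)⁻¹ * q (N - s')) + s + s' ≤ N)
    rcases le_total s s' with hss | hss
    · have hss' : (s : ℝ) ≤ s' := by exact_mod_cast hss
      refine Or.inl (Or.inl (Or.inl ⟨s, hs, by linarith, q s, (q s)⁻¹ * q (N - s'), e⁻¹, ?_, ?_,
        heR', ?_⟩))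
      · exact Nat.cast_le (α := ℝ).2 (hnorm s)
      · show (_ : ℝ) ≤ _
        linarith
      · rw [he]; group
    · have hss' : (s' : ℝ) ≤ s := by exact_mod_cast hss
      refine Or.inl (Or.inr ⟨s', hs', by linarith, g⁻¹ * q (N - s'), ((q s)⁻¹ * q (N - s'))⁻¹, e,
        ?_, ?_, heR, ?_⟩)
      · refine Nat.cast_le (α := ℝ).2 ?_
        have := hq (N - s') N (by omega)
        rw [hqN, ← wordLength_inv hS] at this
        simp only [mul_inv_rev, inv_inv] at this
        omega
      · show (_ : ℝ) ≤ _
        rw [wordLength_inv hS]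
        linarith
      · rw [he]; group
  · refine Or.inl (Or.inl (Or.inr ⟨N - s', s + s' - N, ?_, q (N - s'), (q s)⁻¹ * q (N - s'), e⁻¹,
      ?_, ?_, heR', ?_⟩))
    · have h1 : ((N - s' : ℕ) : ℝ) + ((s + s' - N : ℕ) : ℝ) = s := by
        exact_mod_cast (by omega : N - s' + (s + s' - N) = s)
      have h2 : (s : ℝ) + (⌈ε * (n : ℝ)⌉₊ : ℝ) ≤ N := by exact_mod_cast hsN
      have h3 := Nat.le_ceil (ε * (n : ℝ))
      rw [h1]
      linarith
    · show (_ : ℝ) ≤ _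
      have : (wordLength S (q (N - s')) : ℝ) ≤ (N - s' : ℕ) := Nat.cast_le.2 (hnorm _)
      linarith
    · show (_ : ℝ) ≤ _
      have h1 := hq (N - s') s (by omega)
      rw [← wordLength_inv hS] at h1
      simp only [mul_inv_rev, inv_inv] at h1
      have h2 : (wordLength S ((q s)⁻¹ * q (N - s')) : ℝ) ≤ (s + s' - N : ℕ) :=
        Nat.cast_le.2 (by omega)
      linarith
    · rw [he]; group

/-- The combinatorial core: if both the path to `g` and the path to `g⁻¹` cross many of the
regions, then `g` is exceptional. -/
theorem mem_exceptionalSet_of_crossing (hS : Subgroup.closure (S : Set G) = ⊤)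
    (hb : ∀ i j, 1 ≤ i → i < j → j ≤ M → ∀ u, St j u ∨ En i u)
    (hc : ∀ i, 1 ≤ i → i ≤ M → ∀ u v, St i u → En i v → 4 ≤ wordLength S (u⁻¹ * v))
    {ε R1 : ℝ} (hR1 : 0 ≤ R1) {n m R R3 : ℕ} (hR3 : (R3 : ℝ) ≤ 2 * R1)
    (he : ∀ i, 1 ≤ i → i ≤ M → ∀ u v u' v', St i u → En i v → wordLength S (u⁻¹ * v) ≤ R →
      St i u' → En i v' → wordLength S (u'⁻¹ * v') ≤ R →
      wordLength S (u⁻¹ * u') ≤ R3 ∧ wordLength S (v⁻¹ * v') ≤ R3)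
    {g : G} (hgn : wordLength S g ≤ n)
    (h1 : ∀ i, 1 ≤ i → i ≤ M → St i 1) (hg : ∀ i, 1 ≤ i → i ≤ M → En i g)
    (hback : ∀ i, 1 ≤ i → i + 2 ≤ m → En i g⁻¹) (hm : ⌈ε * (n : ℝ)⌉₊ = m) (hm40 : 40 ≤ m)
    (hM : 3 * m ≤ M + 2) (hR : 8 * (n + 1) < m * R) :
    g ∈ exceptionalSet S ε R1 n := by
  obtain ⟨q, hq0, hqN, hq⟩ := exists_wordGeodesic hS g
  set N := wordLength S g with hN
  set p : ℕ → G := fun t => g⁻¹ * q (N - t) with hp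
  have hp0 : p 0 = 1 := by simp [hp, hqN]
  have hpN : p N = g⁻¹ := by simp [hp, hq0]
  have hpq : ∀ s t, s ≤ t → t ≤ N → wordLength S ((p s)⁻¹ * p t) ≤ t - s := fun s t hst ht => by
    have := hq (N - t) (N - s) (by omega)
    rw [← wordLength_inv hS] at this
    have h' : (p s)⁻¹ * p t = ((q (N - t))⁻¹ * q (N - s))⁻¹ := by simp only [hp]; group
    rw [h']
    omega
  set I := Finset.Icc (m / 2) (m - 2) with hI
  have hIM : I ⊆ Finset.Icc 1 M := fun i hi => by
    rw [hI, Finset.mem_Icc] at hi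
    rw [Finset.mem_Icc]
    omega
  obtain ⟨i, hiI, hiR⟩ : ∃ i ∈ I, (insideTimes St En q 0 N i).card +
      (insideTimes St En p 0 N i).card < R := by
    by_contra! hcon
    have h2 := Finset.card_nsmul_le_sum I _ R hcon
    rw [Finset.sum_add_distrib, smul_eq_mul, hI, Nat.card_Icc, ← hI] at h2
    have h3 := sum_card_insideTimes_le hb q 0 N I hIM
    have h4 := sum_card_insideTimes_le hb p 0 N I hIM
    have h5 : m * R ≤ 4 * (m - 2 + 1 - m / 2) * R := Nat.mul_le_mul_right R (by omega)
    rw [mul_assoc] at h5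
    omega
  rw [hI, Finset.mem_Icc] at hiI
  have hi1 : 1 ≤ i := by omega
  have hiM : i ≤ M := by omega
  obtain ⟨s, t, hst, htN, hs, ht, htR, hsi, hsM⟩ := exists_crossing_bounds hb hc
    (fun s t hst _ => hq s t hst) (fun j hj hjM => hq0 ▸ h1 j hj hjM) hi1 hiM
    (hqN ▸ hg i hi1 hiM)
  obtain ⟨s', t', hst', htN', hs', ht', htR', hsi', -⟩ := exists_crossing_bounds hb hc
    hpq (fun j hj hjM => hp0 ▸ h1 j hj hjM) hi1 hiM (hpN ▸ hback i hi1 (by omega))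
  have hsM' := hsM fun j hj hjM => hqN ▸ hg j (by omega) hjM
  have hclose := (he i hi1 hiM _ _ _ _ hs ht ((hq s t hst).trans (by omega)) hs' ht'
    ((hpq s' t' hst' htN').trans (by omega))).1
  exact mem_exceptionalSet_of_close hS hR1 hgn hR3 hq0 hq hqN (hst'.trans htN')
    (by omega) (by omega) (by omega) hclose

/-- The counterpart of `mem_exceptionalSet_of_crossing` for the path from `g` to `g * g`. -/
theorem mem_exceptionalSet_of_crossing_mul_self (hS : Subgroup.closure (S : Set G) = ⊤)
    (hb : ∀ i j, 1 ≤ i → i < j → j ≤ M → ∀ u, St j u ∨ En i u)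
    (hc : ∀ i, 1 ≤ i → i ≤ M → ∀ u v, St i u → En i v → 4 ≤ wordLength S (u⁻¹ * v))
    {ε R1 : ℝ} (hR1 : 0 ≤ R1) {n m R R3 : ℕ} (hR3 : (R3 : ℝ) ≤ 2 * R1)
    (he : ∀ i, 1 ≤ i → i ≤ M → ∀ u v u' v', St i u → En i v → wordLength S (u⁻¹ * v) ≤ R →
      St i u' → En i v' → wordLength S (u'⁻¹ * v') ≤ R →
      wordLength S (u⁻¹ * u') ≤ R3 ∧ wordLength S (v⁻¹ * v') ≤ R3)
    {g : G} (hgn : wordLength S g ≤ n)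
    (h1 : ∀ i, 1 ≤ i → i ≤ M → St i 1) (hg : ∀ i, 1 ≤ i → i ≤ M → En i g)
    (hback : ∀ i, i ≤ M → M + 3 ≤ i + m → St i (g * g)) (hm : ⌈ε * (n : ℝ)⌉₊ = m)
    (hm40 : 40 ≤ m) (hM : 3 * m ≤ M + 2) (hR : 8 * (n + 1) < m * R) :
    g ∈ exceptionalSet S ε R1 n := by
  have hswap : ∀ u v : G, wordLength S ((g * u)⁻¹ * (g * v)) = wordLength S (u⁻¹ * v) :=
    fun u v => by rw [mul_inv_rev, mul_assoc, inv_mul_cancel_left]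
  have hsymm : ∀ u v : G, wordLength S (u⁻¹ * v) = wordLength S (v⁻¹ * u) := fun u v => by
    rw [← wordLength_inv hS, mul_inv_rev, inv_inv]
  refine inv_mem_exceptionalSet (mem_exceptionalSet_of_crossing (M := M) (R := R)
    (St := fun i u => En (M + 1 - i) (g * u)) (En := fun i u => St (M + 1 - i) (g * u)) hS
    (fun i j hi hij hj u => (hb (M + 1 - j) (M + 1 - i) (by omega) (by omega) (by omega) _).symm)
    (fun i hi hiM u v hu hv => ?_) hR1 hR3
    (fun i hi hiM u v u' v' hu hv huv hu' hv' huv' => ?_) ((wordLength_inv hS g).trans_le hgn)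
    (fun i hi hiM => ?_) (fun i hi hiM => ?_) (fun i hi him => ?_) hm hm40 hM hR)
  · rw [← hswap, hsymm]
    exact hc _ (by omega) (by omega) _ _ hv hu
  · rw [← hswap, hsymm] at huv huv'
    have h := he _ (by omega) (by omega) _ _ _ _ hv hu huv hv' hu' huv'
    rw [hswap, hswap] at h
    exact h.symm
  · simpa using hg _ (by omega) (by omega)
  · simpa using h1 _ (by omega) (by omega)
  · simpa using hback _ (by omega) (by omega)

end Crossing

section Geometry

variable {X : Type*} [MetricSpace X] {δ : ℝ}

namespace GeodesicSegment

theorem initial_mem_seg (γ : GeodesicSegment X) : γ.initial ∈ γ.seg :=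
  ⟨0, ⟨le_rfl, γ.len_nonneg⟩, rfl⟩

theorem terminal_mem_seg (γ : GeodesicSegment X) : γ.terminal ∈ γ.seg :=
  ⟨γ.len, ⟨γ.len_nonneg, le_rfl⟩, rfl⟩

theorem dist_initial_terminal (γ : GeodesicSegment X) : dist γ.initial γ.terminal = γ.len := by
  rw [initial, terminal, γ.isom 0 ⟨le_rfl, γ.len_nonneg⟩ γ.len ⟨γ.len_nonneg, le_rfl⟩, zero_sub,
    abs_neg, abs_of_nonneg γ.len_nonneg]

theorem dist_initial_add_dist_terminal (γ : GeodesicSegment X) {p : X} (hp : p ∈ γ.seg) :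
    dist p γ.initial + dist p γ.terminal = γ.len := by
  obtain ⟨t, ht, rfl⟩ := hp
  rw [initial, terminal, γ.isom t ht 0 ⟨le_rfl, γ.len_nonneg⟩,
    γ.isom t ht γ.len ⟨γ.len_nonneg, le_rfl⟩, sub_zero, abs_of_nonneg ht.1, abs_sub_comm,
    abs_of_nonneg (sub_nonneg.2 ht.2)]
  ring

theorem continuousOn (γ : GeodesicSegment X) : ContinuousOn γ.toFun (Set.Icc 0 γ.len) := by
  refine (LipschitzOnWith.of_dist_le_mul (K := 1) fun s hs t ht => ?_).continuousOn
  rw [γ.isom s hs t ht, Real.dist_eq, NNReal.coe_one, one_mul]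

theorem isCompact_seg (γ : GeodesicSegment X) : IsCompact γ.seg :=
  isCompact_Icc.image_of_continuousOn γ.continuousOn

/-- Points at prescribed distances between two points of a geodesic. -/
theorem exists_between (γ : GeodesicSegment X) {p q : X} (hp : p ∈ γ.seg) (hq : q ∈ γ.seg)
    {t : ℝ} (ht : 0 ≤ t) (htpq : t ≤ dist p q) :
    ∃ y ∈ γ.seg, dist p y = t ∧ dist y q = dist p q - t := by
  obtain ⟨a, ha, rfl⟩ := hp
  obtain ⟨b, hb, rfl⟩ := hq
  rw [γ.isom a ha b hb] at htpq ⊢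
  rcases le_total a b with hab | hab
  · rw [abs_of_nonpos (sub_nonpos.2 hab)] at htpq ⊢
    have hy : a + t ∈ Set.Icc (0 : ℝ) γ.len := ⟨by linarith [ha.1], by linarith [hb.2]⟩
    refine ⟨_, ⟨_, hy, rfl⟩, ?_, ?_⟩
    · rw [γ.isom _ ha _ hy, abs_of_nonpos] <;> linarith
    · rw [γ.isom _ hy _ hb, abs_of_nonpos] <;> linarith
  · rw [abs_of_nonneg (sub_nonneg.2 hab)] at htpq ⊢
    have hy : a - t ∈ Set.Icc (0 : ℝ) γ.len := ⟨by linarith [hb.1], by linarith [ha.2]⟩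
    refine ⟨_, ⟨_, hy, rfl⟩, ?_, ?_⟩
    · rw [γ.isom _ ha _ hy, abs_of_nonneg] <;> linarith
    · rw [γ.isom _ hy _ hb, abs_of_nonneg] <;> linarith

theorem before_of_dist_le (γ : GeodesicSegment X) {p q : X} (hp : p ∈ γ.seg) (hq : q ∈ γ.seg)
    (h : dist p γ.initial ≤ dist q γ.initial) : γ.Before p q := by
  obtain ⟨a, ha, rfl⟩ := hp
  obtain ⟨b, hb, rfl⟩ := hq
  rw [initial, γ.isom a ha 0 ⟨le_rfl, γ.len_nonneg⟩, γ.isom b hb 0 ⟨le_rfl, γ.len_nonneg⟩,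
    sub_zero, sub_zero, abs_of_nonneg ha.1, abs_of_nonneg hb.1] at h
  exact ⟨a, b, ha, hb, h, rfl, rfl⟩

end GeodesicSegment

/-- A point within `δ` of a geodesic from `x` to `y` has small Gromov excess. -/
theorem dist_add_dist_le_of_mem_cthickening (hδ : 0 ≤ δ) {γ : GeodesicSegment X} {u : X}
    (hu : u ∈ Metric.cthickening δ γ.seg) :
    dist γ.initial u + dist u γ.terminal ≤ dist γ.initial γ.terminal + 2 * δ := by
  rw [γ.isCompact_seg.cthickening_eq_biUnion_closedBall hδ] at hu
  obtain ⟨a, ha, hua⟩ := Set.mem_iUnion₂.1 hu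
  rw [Metric.mem_closedBall] at hua
  have h1 := γ.dist_initial_add_dist_terminal ha
  have h2 := dist_triangle γ.initial a u
  have h3 := dist_triangle u a γ.terminal
  rw [dist_comm γ.initial a, dist_comm a u] at h2
  rw [γ.dist_initial_terminal]
  linarith

/-- The four-point inequality. -/
def FourPoint (X : Type*) [MetricSpace X] (δ : ℝ) : Prop :=
  ∀ x y z w : X, dist x z + dist y w ≤ dist x y + dist z w + 4 * δ ∨
    dist x z + dist y w ≤ dist x w + dist y z + 4 * δ

theorem IsDeltaHyperbolic.fourPoint (hδ : 0 ≤ δ) (hgeo : IsGeodesicSpace X)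
    (hhyp : IsDeltaHyperbolic X δ) : FourPoint X δ := by
  intro x y z w
  obtain ⟨γ, rfl, rfl⟩ := hgeo x z
  obtain ⟨γxy, hxy, rfl⟩ := hgeo γ.initial y
  obtain ⟨γyz, hyz, hyz'⟩ := hgeo γxy.terminal γ.terminal
  obtain ⟨γxw, hxw, rfl⟩ := hgeo γ.initial w
  obtain ⟨γwz, hwz, hwz'⟩ := hgeo γxw.terminal γ.terminal
  have hclosed : ∀ η : GeodesicSegment X,
      IsClosed (Set.Icc 0 γ.len ∩ γ.toFun ⁻¹' Metric.cthickening δ η.seg) := fun η =>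
    γ.continuousOn.preimage_isClosed_of_isClosed isClosed_Icc Metric.isClosed_cthickening
  have hcover : ∀ η₁ η₂ : GeodesicSegment X, η₁.initial = γ.initial → η₂.initial = η₁.terminal →
      η₂.terminal = γ.terminal → ∀ t ∈ Set.Icc 0 γ.len,
      γ.toFun t ∈ Metric.cthickening δ η₁.seg ∨ γ.toFun t ∈ Metric.cthickening δ η₂.seg :=
    fun η₁ η₂ h1 h2 h3 t ht => by
      have := hhyp η₁ η₂ γ h1 h2.symm h3 ⟨t, ht, rfl⟩
      rwa [Metric.cthickening_union] at this
  have h0 : (0 : ℝ) ∈ Set.Icc 0 γ.len := ⟨le_rfl, γ.len_nonneg⟩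
  have h1 : γ.len ∈ Set.Icc 0 γ.len := ⟨γ.len_nonneg, le_rfl⟩
  obtain ⟨t, ht, htA, htA'⟩ := isPreconnected_closed_iff.1
    (isPreconnected_Icc (a := (0 : ℝ)) (b := γ.len)) _ _
    (hclosed γxy) (hclosed γyz)
    (fun t ht => (hcover γxy γyz hxy hyz hyz' t ht).imp (fun h => ⟨ht, h⟩) fun h => ⟨ht, h⟩)
    ⟨0, h0, h0, Metric.self_subset_cthickening _
      (show γ.initial ∈ γxy.seg from hxy ▸ γxy.initial_mem_seg)⟩
    ⟨γ.len, h1, h1, Metric.self_subset_cthickening _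
      (show γ.terminal ∈ γyz.seg from hyz' ▸ γyz.terminal_mem_seg)⟩
  have hA := dist_add_dist_le_of_mem_cthickening hδ htA.2
  have hA' := dist_add_dist_le_of_mem_cthickening hδ htA'.2
  have hdiag := γ.dist_initial_add_dist_terminal ⟨t, ht, rfl⟩
  have htri := dist_triangle γxy.terminal (γ.toFun t) γxw.terminal
  rw [← γ.dist_initial_terminal] at hdiag
  rcases hcover γxw γwz hxw hwz hwz' t ht with hB | hB
  all_goals have hB := dist_add_dist_le_of_mem_cthickening hδ hB
  · right
    rw [hyz, hyz'] at hA'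
    rw [hxw] at hB
    rw [dist_comm γ.initial (γ.toFun t)] at hB
    rw [dist_comm (γxy.terminal) (γ.toFun t)] at hA' htri
    linarith
  · left
    rw [hxy] at hA
    rw [hwz, hwz', dist_comm _ (γ.toFun t), dist_comm _ γ.terminal] at hB
    rw [dist_comm γ.initial (γ.toFun t)] at hA
    rw [dist_comm (γxy.terminal) (γ.toFun t)] at htri
    rw [dist_comm (γ.toFun t) γxy.terminal] at hA htri
    linarith [dist_comm γxw.terminal γ.terminal, dist_comm γ.terminal (γ.toFun t)]

theorem exists_mem_proj (γ : GeodesicSegment X) (x : X) : ∃ p, p ∈ proj γ x := by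
  obtain ⟨p, hp, h⟩ := γ.isCompact_seg.exists_infDist_eq_dist ⟨_, γ.initial_mem_seg⟩ x
  exact ⟨p, hp, h.symm⟩

theorem dist_le_of_mem_proj {γ : GeodesicSegment X} {x p q : X} (hp : p ∈ proj γ x)
    (hq : q ∈ γ.seg) : dist x p ≤ dist x q :=
  hp.2 ▸ Metric.infDist_le_dist_of_mem hq

theorem FourPoint.dist_add_dist_le_of_mem_proj (h4 : FourPoint X δ) (hδ : 0 < δ)
    {γ : GeodesicSegment X} {x p q : X} (hp : p ∈ proj γ x) (hq : q ∈ γ.seg) :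
    dist x p + dist p q ≤ dist x q + 9 * δ := by
  rcases le_or_gt (dist p q) (5 * δ) with h | h
  · linarith [dist_le_of_mem_proj hp hq]
  · obtain ⟨y, hy, hpy, hyq⟩ := γ.exists_between hp.1 hq (by positivity : 0 ≤ 5 * δ) h.le
    have hxy := dist_le_of_mem_proj hp hy
    rcases h4 x p y q with h' | h'
    · rw [hyq] at h'; linarith
    · rw [hpy] at h'; linarith

theorem FourPoint.dist_le_of_mem_proj (h4 : FourPoint X δ) (hδ : 0 < δ)
    {γ : GeodesicSegment X} {x p q : X} (hp : p ∈ proj γ x) (hq : q ∈ proj γ x) :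
    dist p q ≤ 9 * δ := by
  have h1 := h4.dist_add_dist_le_of_mem_proj hδ hp hq.1
  have h2 := AcylCount.dist_le_of_mem_proj hq hp.1
  linarith

/-- If two points have distant projections to a geodesic, then any geodesic between them
follows that geodesic. -/
theorem FourPoint.add_dist_add_le_of_mem_proj (h4 : FourPoint X δ) (hδ : 0 < δ)
    {γ : GeodesicSegment X} {x x' p p' : X} (hp : p ∈ proj γ x) (hp' : p' ∈ proj γ x')
    (h : 11 * δ < dist p p') :
    dist x p + dist p p' + dist p' x' ≤ dist x x' + 22 * δ := by
  have h1 := h4.dist_add_dist_le_of_mem_proj hδ hp hp'.1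
  have h2 := h4.dist_add_dist_le_of_mem_proj hδ hp' hp.1
  rw [dist_comm p' p] at h2
  rw [dist_comm p' x']
  have h3 := h4 x x' p' p
  rw [dist_comm p' p, dist_comm x' p'] at h3
  rw [dist_comm x' p'] at h2 ⊢
  rcases h3 with h3 | h3 <;> linarith

/-- The Behrstock-type inequality for consecutive aligned segments. -/
theorem FourPoint.behrstock_of_alignedPair (h4 : FourPoint X δ) (hδ : 0 < δ) {D : ℝ}
    {σ τ : GeodesicSegment X}
    (hστ : ∀ a ∈ τ.seg, ∀ p ∈ proj σ a, dist p σ.terminal < D)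
    (hτσ : ∀ a ∈ σ.seg, ∀ p ∈ proj τ a, dist p τ.initial < D)
    {x p q : X} (hp : p ∈ proj τ x) (hq : q ∈ proj σ x) (h : D + 40 * δ < dist p τ.initial) :
    dist q σ.terminal ≤ D + 11 * δ := by
  obtain ⟨r, hr⟩ := exists_mem_proj τ q
  obtain ⟨q', hq'⟩ := exists_mem_proj σ p
  have h1 := hτσ q hq.1 r hr
  have h2 := hστ p hp.1 q' hq'
  have h3 := dist_triangle p r τ.initial
  have h4' := dist_triangle q q' σ.terminal
  by_contra! hcon
  have h5 := h4.add_dist_add_le_of_mem_proj hδ hp hr (by linarith)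
  have h6 := h4.add_dist_add_le_of_mem_proj hδ hq hq' (by linarith)
  have := dist_nonneg (x := r) (y := q)
  have := dist_nonneg (x := q') (y := p)
  linarith

/-- The Behrstock-type inequality for a sequence of long aligned segments. -/
theorem FourPoint.behrstock_of_alignedSeq (h4 : FourPoint X δ) (hδ : 0 < δ) {D : ℝ} {M : ℕ}
    {σ : ℕ → GeodesicSegment X} (hlong : ∀ i, 2 * D + 60 * δ < (σ i).len)
    (hστ : ∀ i, 1 ≤ i → i < M →
      ∀ a ∈ (σ (i + 1)).seg, ∀ p ∈ proj (σ i) a, dist p (σ i).terminal < D)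
    (hτσ : ∀ i, 1 ≤ i → i < M →
      ∀ a ∈ (σ i).seg, ∀ p ∈ proj (σ (i + 1)) a, dist p (σ (i + 1)).initial < D)
    {x p q : X} {i j : ℕ} (hi : 1 ≤ i) (hij : i < j) (hj : j ≤ M)
    (hp : p ∈ proj (σ j) x) (hq : q ∈ proj (σ i) x)
    (h : D + 40 * δ < dist p (σ j).initial) :
    dist q (σ i).terminal ≤ D + 11 * δ := by
  induction j, hij using Nat.le_induction generalizing p with
  | base => exact h4.behrstock_of_alignedPair hδ (hστ i hi hj) (hτσ i hi hj) hp hq h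
  | succ j hij ih =>
    obtain ⟨r, hr⟩ := exists_mem_proj (σ j) x
    have h1 := h4.behrstock_of_alignedPair hδ (hστ j (by omega) hj) (hτσ j (by omega) hj) hp hr h
    have h2 := (σ j).dist_initial_add_dist_terminal hr.1
    exact ih (by omega) hr (by linarith [hlong j])

theorem isBounded_projSet_union (γ : GeodesicSegment X) (A : Set X) {p : X} (hp : p ∈ γ.seg) :
    Bornology.IsBounded (projSet γ A ∪ {p}) :=
  γ.isCompact_seg.isBounded.subset <| Set.union_subset
    (Set.iUnion₂_subset fun _ _ _ h => h.1) (Set.singleton_subset_iff.2 hp)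

theorem dist_lt_of_diam_projSet_lt {γ : GeodesicSegment X} {A : Set X} {K : ℝ} {a p e : X}
    (he : e ∈ γ.seg) (h : Metric.diam (projSet γ A ∪ {e}) < K) (ha : a ∈ A)
    (hp : p ∈ proj γ a) : dist p e < K :=
  (Metric.dist_le_diam_of_mem (isBounded_projSet_union γ A he)
    (Or.inl (Set.mem_iUnion₂.2 ⟨a, ha, hp⟩)) (Or.inr rfl)).trans_lt h

@[simp]
theorem seg_point (x : X) : (GeodesicSegment.point x).seg = {x} := by
  ext y
  simp [GeodesicSegment.seg, GeodesicSegment.point, eq_comm]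

@[simp]
theorem initial_point (x : X) : (GeodesicSegment.point x).initial = x := rfl

@[simp]
theorem terminal_point (x : X) : (GeodesicSegment.point x).terminal = x := rfl

theorem diam_projSet_point (x : X) (A : Set X) :
    Metric.diam (projSet (GeodesicSegment.point x) A ∪ {x}) = 0 := by
  refine Metric.diam_subsingleton (Set.subsingleton_singleton.anti (t := {x}) ?_)
  refine Set.union_subset (Set.iUnion₂_subset fun _ _ p hp => ?_) le_rfl
  simpa using hp.1

theorem FourPoint.diam_projSet_singleton_le (h4 : FourPoint X δ) (hδ : 0 < δ) {B : ℝ}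
    {γ : GeodesicSegment X} {x e : X} (hB : 9 * δ ≤ B) (h : ∀ p ∈ proj γ x, dist p e ≤ B) :
    Metric.diam (projSet γ {x} ∪ {e}) ≤ B := by
  refine Metric.diam_le_of_forall_dist_le (by linarith) ?_
  simp only [projSet, Set.mem_singleton_iff, Set.iUnion_iUnion_eq_left]
  rintro p (hp | rfl) q (hq | rfl)
  · exact (h4.dist_le_of_mem_proj hδ hp hq).trans hB
  · exact h p hp
  · rw [dist_comm]; exact h q hq
  · rw [dist_self]; linarith

theorem FourPoint.alignedPair_point_left (h4 : FourPoint X δ) (hδ : 0 < δ) {B K : ℝ}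
    {γ : GeodesicSegment X} {x : X} (hB : 9 * δ ≤ B) (hBK : B < K)
    (h : ∀ p ∈ proj γ x, dist p γ.initial ≤ B) :
    AlignedPair K (GeodesicSegment.point x) γ := by
  refine ⟨?_, ?_⟩
  · rw [terminal_point, diam_projSet_point]; linarith
  · rw [seg_point]; exact (h4.diam_projSet_singleton_le hδ hB h).trans_lt hBK

theorem FourPoint.alignedPair_point_right (h4 : FourPoint X δ) (hδ : 0 < δ) {B K : ℝ}
    {γ : GeodesicSegment X} {x : X} (hB : 9 * δ ≤ B) (hBK : B < K)
    (h : ∀ p ∈ proj γ x, dist p γ.terminal ≤ B) :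
    AlignedPair K γ (GeodesicSegment.point x) := by
  refine ⟨?_, ?_⟩
  · rw [seg_point]; exact (h4.diam_projSet_singleton_le hδ hB h).trans_lt hBK
  · rw [initial_point, diam_projSet_point]; linarith

/-- Two points at comparable positions near a common geodesic are close. -/
theorem FourPoint.dist_le_of_near (h4 : FourPoint X δ) {x x' y y' : X} {F : ℝ}
    (h : dist x y + dist y' x' ≤ dist x x' + F) (h' : dist x y' + dist y x' ≤ dist x x' + F) :
    dist y y' ≤ F + 4 * δ := by
  have := h4 x y x' y'
  rw [dist_comm x' y'] at this
  rcases this with this | this <;> linarith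

/-- A geodesic between two points whose projections to a long segment are near opposite ends
follows that segment. -/
theorem FourPoint.dist_add_len_add_dist_le (h4 : FourPoint X δ) (hδ : 0 < δ) {B : ℝ}
    {γ : GeodesicSegment X} (hlong : 2 * B + 11 * δ < γ.len) {x x' : X}
    (hx : ∀ p ∈ proj γ x, dist p γ.initial ≤ B) (hx' : ∀ p ∈ proj γ x', dist p γ.terminal ≤ B) :
    dist x γ.initial + γ.len + dist γ.terminal x' ≤ dist x x' + (4 * B + 22 * δ) := by
  obtain ⟨p, hp⟩ := exists_mem_proj γ x
  obtain ⟨q, hq⟩ := exists_mem_proj γ x'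
  have h1 := hx p hp
  have h2 := hx' q hq
  have h3 := γ.dist_initial_terminal
  have h5 := dist_triangle4 γ.initial p q γ.terminal
  rw [dist_comm γ.initial p] at h5
  have h6 := h4.add_dist_add_le_of_mem_proj hδ hp hq (by linarith)
  have h7 := dist_triangle x p γ.initial
  have h8 := dist_triangle γ.terminal q x'
  rw [dist_comm γ.terminal q] at h8
  linarith

theorem alignedSeq_iff {K : ℝ} {G : Type*} (ρ : G → X → X) (hisom : ∀ g : G, Isometry (ρ g))
    (Υ : GeodesicSegment X) (h : ℕ → G) {m : ℕ} (hm : 1 ≤ m) (a b : GeodesicSegment X) :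
    AlignedSeq K ([a] ++ transList ρ hisom Υ h m ++ [b]) ↔
      AlignedPair K a (Υ.translate (ρ (h 1)) (hisom _)) ∧
      (∀ i, 1 ≤ i → i < m → AlignedPair K (Υ.translate (ρ (h i)) (hisom _))
        (Υ.translate (ρ (h (i + 1))) (hisom _))) ∧
      AlignedPair K (Υ.translate (ρ (h m)) (hisom _)) b := by
  obtain ⟨m, rfl⟩ := Nat.exists_eq_add_of_le' hm
  change List.IsChain _ _ ↔ _
  rw [List.append_assoc, List.singleton_append, List.isChain_cons, List.isChain_append, transList,
    List.isChain_map, List.isChain_range]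
  simp only [List.head?_map, List.getLast?_map, List.head?_append, List.head?_range,
    List.getLast?_range, List.head?_singleton, Nat.add_one_ne_zero, if_false, Option.map_some,
    Option.some_or, Option.mem_some_iff, List.isChain_singleton, Nat.succ_sub_one,
    forall_eq', true_and, zero_add]
  refine and_congr_right fun _ => and_congr_left fun _ => ⟨fun H i hi him => ?_, fun H i hi => ?_⟩
  · obtain ⟨i, rfl⟩ := Nat.exists_eq_add_of_le' hi
    exact H i (by omega)
  · exact H (i + 1) (by omega) (by omega)

end Geometry

section Action

variable {G : Type*} [Group G] {X : Type*} [MetricSpace X] {S : Finset G} {δ : ℝ}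
  {ρ : G → X → X} {x0 : X} {φ : G}

theorem dist_smul_smul (hisom : ∀ g : G, Isometry (ρ g))
    (hmul : ∀ g h : G, ∀ x : X, ρ (g * h) x = ρ g (ρ h x)) (g u v : G) :
    dist (ρ (g * u) x0) (ρ (g * v) x0) = dist (ρ u x0) (ρ v x0) := by
  rw [hmul, hmul, (hisom g).dist_eq]

theorem exists_orbit_lipschitz (hS : Subgroup.closure (S : Set G) = ⊤)
    (hisom : ∀ g : G, Isometry (ρ g)) (hmul : ∀ g h : G, ∀ x : X, ρ (g * h) x = ρ g (ρ h x))
    (hone : ∀ x : X, ρ 1 x = x) (x0 : X) :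
    ∃ K : ℝ, 0 ≤ K ∧ ∀ u v : G, dist (ρ u x0) (ρ v x0) ≤ K * wordLength S (u⁻¹ * v) := by
  set K := ∑ s ∈ S, dist x0 (ρ s x0)
  have hsum : ∀ s ∈ S, dist x0 (ρ s x0) ≤ K := fun s hs =>
    Finset.single_le_sum (f := fun s => dist x0 (ρ s x0)) (fun _ _ => dist_nonneg) hs
  have hlist : ∀ l : List G, (∀ x ∈ l, x ∈ S ∨ x⁻¹ ∈ S) →
      dist x0 (ρ l.prod x0) ≤ K * l.length := by
    intro l
    induction l with
    | nil => simp [hone]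
    | cons a l ih =>
      intro hl
      have h1 := ih fun x hx => hl x (by simp [hx])
      have h2 : dist x0 (ρ a x0) ≤ K := by
        rcases hl a (by simp) with h | h
        · exact hsum a h
        · have h3 := hsum _ h
          rwa [← (hisom a).dist_eq, ← hmul, mul_inv_cancel, hone, dist_comm] at h3
      have h3 := dist_triangle x0 (ρ a x0) (ρ (a * l.prod) x0)
      rw [hmul, (hisom a).dist_eq, ← hmul] at h3
      rw [List.prod_cons, List.length_cons]
      push_cast
      linarith
  refine ⟨K, Finset.sum_nonneg fun _ _ => dist_nonneg, fun u v => ?_⟩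
  obtain ⟨l, hl, hlS, hlp⟩ := exists_list_length_eq_wordLength hS (u⁻¹ * v)
  have h := hlist l hlS
  rw [hl, hlp, ← (hisom u).dist_eq, ← hmul, mul_inv_cancel_left] at h
  exact h

/-- A geodesic from `u x₀` to `v x₀` follows `h [x₀, φ^L x₀]`, up to an error `E`. -/
def Follows (ρ : G → X → X) (x0 : X) (φ : G) (L : ℕ) (E : ℝ) (u h v : G) : Prop :=
  dist (ρ u x0) (ρ h x0) + dist (ρ h x0) (ρ (h * φ ^ L) x0) +
    dist (ρ (h * φ ^ L) x0) (ρ v x0) ≤ dist (ρ u x0) (ρ v x0) + E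

theorem Follows.mul_left (hisom : ∀ g : G, Isometry (ρ g))
    (hmul : ∀ g h : G, ∀ x : X, ρ (g * h) x = ρ g (ρ h x)) {L : ℕ} {E : ℝ} {u h v : G}
    (H : Follows ρ x0 φ L E u h v) (g : G) : Follows ρ x0 φ L E (g * u) (g * h) (g * v) := by
  unfold Follows at H ⊢
  rw [mul_assoc]
  simp only [dist_smul_smul hisom hmul]
  exact H

/-- Two translates of `[x₀, φ^L x₀]` followed by a common geodesic at nearly the same place
are close in the word metric. -/
theorem Follows.wordLength_le (hS : Subgroup.closure (S : Set G) = ⊤)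
    (h4 : FourPoint X δ) (hisom : ∀ g : G, Isometry (ρ g))
    (hmul : ∀ g h : G, ∀ x : X, ρ (g * h) x = ρ g (ρ h x)) {E0 : ℝ}
    (hE0 : E0Spec S ρ x0 φ E0) {L : ℕ} (hL : 0 < L) {Υ : GeodesicSegment X}
    (hΥ : Υ.initial = x0) (hΥ' : Υ.terminal = ρ (φ ^ L) x0) {E : ℝ}
    (hlong : 4 * (E + 1 + 4 * δ) + E0 < Υ.len) {u k k' v : G}
    (H : Follows ρ x0 φ L E u k v) (H' : Follows ρ x0 φ L E u k' v)
    (hkk : |dist (ρ u x0) (ρ k x0) - dist (ρ u x0) (ρ k' x0)| ≤ 1) :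
    (wordLength S (k⁻¹ * k') : ℝ) ≤ 2 * L * wordLength S φ + E0 := by
  obtain ⟨hE0pos, -, hE0'⟩ := hE0
  have hlen : ∀ h : G, dist (ρ h x0) (ρ (h * φ ^ L) x0) = Υ.len := fun h => by
    rw [← Υ.dist_initial_terminal, hΥ, hΥ', hmul, (hisom h).dist_eq]
  unfold Follows at H H'
  rw [hlen] at H H'
  obtain ⟨hkk1, hkk2⟩ := abs_le.1 hkk
  have hy : dist (ρ k x0) (ρ k' x0) ≤ E + 1 + 4 * δ := by
    have h1 := dist_triangle (ρ k x0) (ρ (k * φ ^ L) x0) (ρ v x0)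
    have h2 := dist_triangle (ρ k' x0) (ρ (k' * φ ^ L) x0) (ρ v x0)
    rw [hlen] at h1 h2
    exact h4.dist_le_of_near (x := ρ u x0) (x' := ρ v x0) (by linarith) (by linarith)
  have hz : dist (ρ (k * φ ^ L) x0) (ρ (k' * φ ^ L) x0) ≤ E + 1 + 4 * δ := by
    have h1 := dist_triangle (ρ u x0) (ρ k x0) (ρ (k * φ ^ L) x0)
    have h2 := dist_triangle (ρ u x0) (ρ k' x0) (ρ (k' * φ ^ L) x0)
    rw [hlen] at h1 h2
    exact h4.dist_le_of_near (x := ρ u x0) (x' := ρ v x0) (by linarith) (by linarith)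
  have hy' : dist (ρ (k⁻¹ * k') x0) Υ.initial ≤ E + 1 + 4 * δ := by
    rw [hΥ, ← (hisom k).dist_eq, ← hmul, mul_inv_cancel_left, dist_comm]
    exact hy
  have hz' : dist (ρ (k⁻¹ * k' * φ ^ L) x0) Υ.terminal ≤ E + 1 + 4 * δ := by
    rw [hΥ', ← (hisom k).dist_eq, ← hmul, ← hmul, mul_assoc, mul_inv_cancel_left, dist_comm]
    exact hz
  obtain ⟨p, hp⟩ := exists_mem_proj Υ (ρ (k⁻¹ * k') x0)
  obtain ⟨q, hq⟩ := exists_mem_proj Υ (ρ (k⁻¹ * k' * φ ^ L) x0)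
  have hp1 := dist_le_of_mem_proj hp Υ.initial_mem_seg
  have hq1 := dist_le_of_mem_proj hq Υ.terminal_mem_seg
  have hp2 := dist_triangle_left p Υ.initial (ρ (k⁻¹ * k') x0)
  have hq2 := dist_triangle_left q Υ.terminal (ρ (k⁻¹ * k' * φ ^ L) x0)
  have hq3 := Υ.dist_initial_add_dist_terminal hq.1
  have hpq := dist_triangle q p Υ.initial
  rw [dist_comm q p] at hpq
  obtain ⟨i, j, hi, hj, hij⟩ := hE0' L hL (k⁻¹ * k') Υ hΥ hΥ' p hp q hq
    (Υ.before_of_dist_le hp.1 hq.1 (by linarith)) (by linarith)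
  have h1 : wordLength S (k⁻¹ * k') ≤
      i * wordLength S φ + wordDist S (φ ^ i) (k⁻¹ * k' * φ ^ j) + j * wordLength S φ := by
    have h2 : k⁻¹ * k' = φ ^ i * ((φ ^ i)⁻¹ * (k⁻¹ * k' * φ ^ j)) * (φ ^ j)⁻¹ := by group
    calc wordLength S (k⁻¹ * k')
        = wordLength S (φ ^ i * ((φ ^ i)⁻¹ * (k⁻¹ * k' * φ ^ j)) * (φ ^ j)⁻¹) := by rw [← h2]
      _ ≤ _ := (wordLength_mul_le hS _ _).trans (add_le_add ((wordLength_mul_le hS _ _).trans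
        (add_le_add (wordLength_pow_le hS _ _) le_rfl))
        ((wordLength_inv hS _).le.trans (wordLength_pow_le hS _ _)))
  have h2 : (i * wordLength S φ + j * wordLength S φ : ℕ) ≤ 2 * L * wordLength S φ := by
    have := Nat.mul_le_mul_right (wordLength S φ) hi
    have := Nat.mul_le_mul_right (wordLength S φ) hj
    linarith
  have h1' : (wordLength S (k⁻¹ * k') : ℝ) ≤
      i * wordLength S φ + wordDist S (φ ^ i) (k⁻¹ * k' * φ ^ j) + j * wordLength S φ := by
    exact_mod_cast h1
  have h2' : (i * wordLength S φ + j * wordLength S φ : ℝ) ≤ 2 * L * wordLength S φ := by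
    exact_mod_cast h2
  linarith

/-- The translates of `[x₀, φ^L x₀]` followed by geodesics from `x₀` to points of a word-metric
ball form a bounded set in the word metric. -/
theorem exists_wordLength_le_of_follows (hS : Subgroup.closure (S : Set G) = ⊤)
    (h4 : FourPoint X δ) (hisom : ∀ g : G, Isometry (ρ g))
    (hmul : ∀ g h : G, ∀ x : X, ρ (g * h) x = ρ g (ρ h x)) {E0 : ℝ}
    (hE0 : E0Spec S ρ x0 φ E0) {L : ℕ} (hL : 0 < L) {Υ : GeodesicSegment X}
    (hΥ : Υ.initial = x0) (hΥ' : Υ.terminal = ρ (φ ^ L) x0) {E : ℝ}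
    (hlong : 4 * (E + 1 + 4 * δ) + E0 < Υ.len) (R : ℕ) :
    ∃ R2 : ℕ, ∀ u h v : G, wordLength S (u⁻¹ * v) ≤ R → Follows ρ x0 φ L E u h v →
      wordLength S (u⁻¹ * h) ≤ R2 := by
  have hclass : ∀ (w : G) (a : ℕ), ∃ r : ℕ, ∀ k, Follows ρ x0 φ L E 1 k w →
      ⌊dist (ρ 1 x0) (ρ k x0)⌋₊ = a → wordLength S k ≤ r := by
    intro w a
    by_cases hne : ∃ k, Follows ρ x0 φ L E 1 k w ∧ ⌊dist (ρ 1 x0) (ρ k x0)⌋₊ = a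
    · obtain ⟨k0, hk0, hk0a⟩ := hne
      refine ⟨wordLength S k0 + ⌈2 * L * wordLength S φ + E0⌉₊, fun k hk hka => ?_⟩
      have h1 := Nat.floor_eq_iff dist_nonneg |>.1 hk0a
      have h2 := Nat.floor_eq_iff dist_nonneg |>.1 hka
      have h3 := Follows.wordLength_le hS h4 hisom hmul hE0 hL hΥ hΥ' hlong hk0 hk
        (abs_le.2 ⟨by linarith, by linarith⟩)
      have h5 := wordLength_mul_le hS k0 (k0⁻¹ * k)
      rw [mul_inv_cancel_left] at h5
      have h6 : wordLength S (k0⁻¹ * k) ≤ ⌈2 * L * wordLength S φ + E0⌉₊ := by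
        exact_mod_cast h3.trans (Nat.le_ceil _)
      omega
    · exact ⟨0, fun k hk hka => (hne ⟨k, hk, hka⟩).elim⟩
  choose r hr using hclass
  have hball := finite_setOf_wordLength_le hS R
  have hw : ∀ w : G, ∃ r : ℕ, ∀ k, Follows ρ x0 φ L E 1 k w → wordLength S k ≤ r := by
    intro w
    obtain ⟨b, hb⟩ := ((Set.finite_Iic ⌊dist (ρ 1 x0) (ρ w x0) + E⌋₊).image (r w)).bddAbove
    refine ⟨b, fun k hk => (hr w _ k hk rfl).trans (hb ⟨_, Nat.floor_le_floor ?_, rfl⟩)⟩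
    have := dist_nonneg (x := ρ k x0) (y := ρ (k * φ ^ L) x0)
    have := dist_nonneg (x := ρ (k * φ ^ L) x0) (y := ρ w x0)
    unfold Follows at hk
    linarith
  choose r' hr' using hw
  obtain ⟨b, hb⟩ := (hball.image r').bddAbove
  refine ⟨b, fun u h v huv H => ?_⟩
  have H' := H.mul_left hisom hmul u⁻¹
  rw [inv_mul_cancel] at H'
  exact (hr' _ _ H').trans (hb ⟨_, huv, rfl⟩)

theorem exists_wordLength_le_of_follows_follows (hS : Subgroup.closure (S : Set G) = ⊤)
    (h4 : FourPoint X δ) (hisom : ∀ g : G, Isometry (ρ g))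
    (hmul : ∀ g h : G, ∀ x : X, ρ (g * h) x = ρ g (ρ h x)) {E0 : ℝ}
    (hE0 : E0Spec S ρ x0 φ E0) {L : ℕ} (hL : 0 < L) {Υ : GeodesicSegment X}
    (hΥ : Υ.initial = x0) (hΥ' : Υ.terminal = ρ (φ ^ L) x0) {E : ℝ}
    (hlong : 4 * (E + 1 + 4 * δ) + E0 < Υ.len) (R : ℕ) :
    ∃ R3 : ℕ, ∀ h u v u' v' : G, Follows ρ x0 φ L E u h v → wordLength S (u⁻¹ * v) ≤ R →
      Follows ρ x0 φ L E u' h v' → wordLength S (u'⁻¹ * v') ≤ R →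
      wordLength S (u⁻¹ * u') ≤ R3 ∧ wordLength S (v⁻¹ * v') ≤ R3 := by
  obtain ⟨R2, hR2⟩ :=
    exists_wordLength_le_of_follows hS h4 hisom hmul hE0 hL hΥ hΥ' hlong R
  refine ⟨2 * R2 + 2 * R, fun h u v u' v' H huv H' huv' => ?_⟩
  have h1 := hR2 u h v huv H
  have h2 := hR2 u' h v' huv' H'
  have h3 : wordLength S (u⁻¹ * u') ≤ R2 + R2 := by
    have h5 := wordLength_mul_le hS (u⁻¹ * h) (u'⁻¹ * h)⁻¹
    rw [wordLength_inv hS, show u⁻¹ * h * (u'⁻¹ * h)⁻¹ = u⁻¹ * u' by group] at h5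
    omega
  have h5 := wordLength_mul_le hS ((u⁻¹ * v)⁻¹ * (u⁻¹ * u')) (u'⁻¹ * v')
  have h6 := wordLength_mul_le hS (u⁻¹ * v)⁻¹ (u⁻¹ * u')
  rw [wordLength_inv hS] at h6
  rw [show (u⁻¹ * v)⁻¹ * (u⁻¹ * u') * (u'⁻¹ * v') = v⁻¹ * v' by group] at h5
  omega

theorem IsLoxodromic.exists_lt_dist (h : IsLoxodromic ρ x0 φ) (C : ℝ) :
    ∃ L1 : ℝ, 0 < L1 ∧ ∀ L : ℕ, L1 < L → C < dist x0 (ρ (φ ^ L) x0) := by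
  obtain ⟨τ, hτ, hlim⟩ := h
  have h1 := hlim.pos_mul_atTop hτ tendsto_natCast_atTop_atTop
  obtain ⟨N, hN⟩ := Filter.eventually_atTop.1 (h1.eventually_gt_atTop C)
  refine ⟨N + 1, by positivity, fun L hL => ?_⟩
  have hL0 : (L : ℝ) ≠ 0 := by
    have : (0 : ℝ) ≤ N := N.cast_nonneg
    linarith
  have := hN L (by exact_mod_cast (by linarith : (N : ℝ) ≤ L))
  rwa [div_mul_cancel₀ _ hL0] at this

end Action

/-- Key inclusion in the proof of Lemma 4.6:
`V_{L,3ε}(n)` minus the exceptional sets is contained in `W_{L,ε}(n)`. -/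
theorem V_minus_K_subset_W {G : Type*} [Group G] {X : Type*} [MetricSpace X]
    (S : Finset G) (hSgen : Subgroup.closure (S : Set G) = ⊤)
    (hNVC : NonVirtuallyCyclic G)
    (δ : ℝ) (hδ : 0 < δ) (hgeo : IsGeodesicSpace X) (hhyp : IsDeltaHyperbolic X δ)
    (ρ : G → X → X) (hisom : ∀ g : G, Isometry (ρ g))
    (hmul : ∀ g h : G, ∀ x : X, ρ (g * h) x = ρ g (ρ h x)) (hone : ∀ x : X, ρ 1 x = x)
    (x0 : X) (φ : G)
    (hlox : IsLoxodromic ρ x0 φ) (hwpd : HasWPD ρ x0 φ)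
    (E0 : ℝ) (hE0 : E0Spec S ρ x0 φ E0) :
    ∃ L1 : ℝ, 0 < L1 ∧ ∀ L : ℕ, L1 < (L : ℝ) →
      ∀ Υ : GeodesicSegment X, Υ.initial = x0 → Υ.terminal = ρ (φ ^ L) x0 →
      ∀ ε : ℝ, 0 < ε → ∃ R1 : ℝ, 0 < R1 ∧ ∃ N : ℕ, ∀ n : ℕ, N ≤ n →
        Vset S ρ hisom x0 δ E0 Υ (3 * ε) n \
            (K1set S ε R1 n ∪ K2set S ε R1 n ∪ (K1set S ε R1 n)⁻¹ ∪ (K2set S ε R1 n)⁻¹)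
          ⊆ Wset S ρ hisom x0 δ E0 Υ ε n := by
  obtain ⟨K, hK, hlip⟩ := exists_orbit_lipschitz hSgen hisom hmul hone x0
  have h4 := hhyp.fourPoint hδ.le hgeo
  have hE0pos := hE0.1
  obtain ⟨D, hD⟩ : ∃ D, D = 6 * E0 + 300 * δ := ⟨_, rfl⟩
  obtain ⟨B, hB⟩ : ∃ B, B = D + 40 * δ := ⟨_, rfl⟩
  obtain ⟨E, hE⟩ : ∃ E, E = 4 * B + 22 * δ := ⟨_, rfl⟩
  obtain ⟨L1, hL1, hlong⟩ := hlox.exists_lt_dist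
    ((2 * D + 60 * δ) + (2 * B + 11 * δ) + (E + 3 * K) + (4 * (E + 1 + 4 * δ) + E0))
  refine ⟨L1, hL1, fun L hL Υ hΥ hΥ' ε hε => ?_⟩
  have hL0 : 0 < L := by exact_mod_cast hL1.trans hL
  have hlen := hlong L hL
  rw [← hΥ', ← hΥ, Υ.dist_initial_terminal] at hlen
  obtain ⟨R3, hR3⟩ := exists_wordLength_le_of_follows_follows hSgen h4 hisom hmul hE0 hL0 hΥ hΥ'
    (E := E) (by linarith) (⌈16 / ε⌉₊ + 1)
  refine ⟨R3 + 1, by positivity, max 2 ⌈40 / ε⌉₊, fun n hn g ⟨⟨hgn, h, hh⟩, hgK⟩ => ?_⟩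
  have hgn' : wordLength S g ≤ n := Nat.cast_le (α := ℝ).1 hgn
  obtain ⟨m, hm⟩ : ∃ m, ⌈ε * (n : ℝ)⌉₊ = m := ⟨_, rfl⟩
  obtain ⟨M, hM⟩ : ∃ M, ⌈3 * ε * (n : ℝ)⌉₊ = M := ⟨_, rfl⟩
  have hεn : ε * n ≤ m := hm ▸ Nat.le_ceil _
  have hm40 : 40 ≤ m := by
    have h1 : 40 / ε ≤ n := (Nat.le_ceil _).trans (by exact_mod_cast (le_max_right _ _).trans hn)
    rw [div_le_iff₀' hε] at h1
    exact_mod_cast h1.trans hεn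
  have hmM : 3 * m ≤ M + 2 := by
    have h1 : 3 * ε * n ≤ M := hM ▸ Nat.le_ceil _
    have h2 : (m : ℝ) < ε * n + 1 := hm ▸ Nat.ceil_lt_add_one (by positivity)
    have h3 : ((3 * m : ℕ) : ℝ) < ((M + 3 : ℕ) : ℝ) := by
      push_cast
      linarith
    have := Nat.cast_lt.1 h3
    omega
  have hmR : 8 * (n + 1) < m * (⌈16 / ε⌉₊ + 1) := by
    have h1 : 16 * (n : ℝ) ≤ m * ⌈16 / ε⌉₊ := by
      have h2 := Nat.le_ceil (16 / ε)
      calc 16 * (n : ℝ) = ε * n * (16 / ε) := by field_simp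
        _ ≤ m * ⌈16 / ε⌉₊ := by gcongr
    have h3 : 16 * n ≤ m * ⌈16 / ε⌉₊ := by exact_mod_cast h1
    rw [mul_add_one m]
    omega
  have hpos : 9 * δ ≤ B := by linarith
  have hBK : B < 6 * E0 + 360 * δ := by linarith
  rw [hM, ← hD] at hh
  set σ : ℕ → GeodesicSegment X := fun i => Υ.translate (ρ (h i)) (hisom _) with hσ
  have hσi : ∀ i, (σ i).initial = ρ (h i) x0 := fun i => by rw [← hΥ]; rfl
  have hσt : ∀ i, (σ i).terminal = ρ (h i * φ ^ L) x0 := fun i => by rw [hmul, ← hΥ']; rfl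
  have hσl : ∀ i, (σ i).len = Υ.len := fun i => rfl
  obtain ⟨hfirst, hmid, hlast⟩ := (alignedSeq_iff ρ hisom Υ h (by omega) _ _).1 hh
  have hbeh : ∀ {x p q : X} {i j : ℕ}, 1 ≤ i → i < j → j ≤ M → p ∈ proj (σ j) x →
      q ∈ proj (σ i) x → B < dist p (σ j).initial → dist q (σ i).terminal ≤ B :=
    fun hi hij hj hp hq hlt => (h4.behrstock_of_alignedSeq (σ := σ) hδ
      (fun i => by rw [hσl]; linarith)
      (fun i hi hiM a ha p hp =>
        dist_lt_of_diam_projSet_lt (σ i).terminal_mem_seg (hmid i hi hiM).1 ha hp)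
      (fun i hi hiM a ha p hp =>
        dist_lt_of_diam_projSet_lt (σ (i + 1)).initial_mem_seg (hmid i hi hiM).2 ha hp)
      hi hij hj hp hq (hB ▸ hlt)).trans (by linarith)
  set St : ℕ → G → Prop := fun i u => ∀ p ∈ proj (σ i) (ρ u x0), dist p (σ i).initial ≤ B
    with hSt
  set En : ℕ → G → Prop := fun i u => ∀ p ∈ proj (σ i) (ρ u x0), dist p (σ i).terminal ≤ B
    with hEn
  have hb : ∀ i j, 1 ≤ i → i < j → j ≤ M → ∀ u, St j u ∨ En i u := by
    intro i j hi hij hj u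
    by_contra! hcon
    obtain ⟨hj', hi'⟩ := hcon
    simp only [hSt, hEn, not_forall, not_le] at hj' hi'
    obtain ⟨p, hp, hp'⟩ := hj'
    obtain ⟨q, hq, hq'⟩ := hi'
    exact hq'.not_ge (hbeh hi hij hj hp hq hp')
  have hfol : ∀ {i u v}, St i u → En i v → Follows ρ x0 φ L E u (h i) v := by
    intro i u v hu hv
    have := h4.dist_add_len_add_dist_le hδ (γ := σ i) (by rw [hσl]; linarith) hu hv
    rwa [← (σ i).dist_initial_terminal, hσi, hσt, ← hE] at this
  have hc : ∀ i, 1 ≤ i → i ≤ M → ∀ u v, St i u → En i v → 4 ≤ wordLength S (u⁻¹ * v) := by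
    intro i _ _ u v hu hv
    by_contra! hlt
    have h1 := h4.dist_add_len_add_dist_le hδ (γ := σ i) (by rw [hσl]; linarith) hu hv
    have h2 : K * wordLength S (u⁻¹ * v) ≤ K * 3 := by
      gcongr
      exact_mod_cast (by omega : wordLength S (u⁻¹ * v) ≤ 3)
    have h3 := hlip u v
    have h5 := dist_nonneg (x := ρ u x0) (y := (σ i).initial)
    have h6 := dist_nonneg (x := (σ i).terminal) (y := ρ v x0)
    rw [hσl] at h1
    linarith
  have he : ∀ i, 1 ≤ i → i ≤ M → ∀ u v u' v', St i u → En i v →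
      wordLength S (u⁻¹ * v) ≤ ⌈16 / ε⌉₊ + 1 → St i u' → En i v' →
      wordLength S (u'⁻¹ * v') ≤ ⌈16 / ε⌉₊ + 1 →
      wordLength S (u⁻¹ * u') ≤ R3 ∧ wordLength S (v⁻¹ * v') ≤ R3 :=
    fun i _ _ u v u' v' hu hv huv hu' hv' huv' =>
      hR3 (h i) u v u' v' (hfol hu hv) huv (hfol hu' hv') huv'
  have hfirst' : ∀ p ∈ proj (σ 1) (ρ 1 x0), dist p (σ 1).initial < D := fun p hp =>
    dist_lt_of_diam_projSet_lt (σ 1).initial_mem_seg hfirst.2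
      (show ρ 1 x0 ∈ (GeodesicSegment.point x0).seg by simp [hone]) hp
  have hlast' : ∀ p ∈ proj (σ M) (ρ g x0), dist p (σ M).terminal < D := fun p hp =>
    dist_lt_of_diam_projSet_lt (σ M).terminal_mem_seg hlast.1
      (show ρ g x0 ∈ (GeodesicSegment.point (ρ g x0)).seg by simp) hp
  have hSt1 : ∀ i, 1 ≤ i → i ≤ M → St i 1 := by
    intro i hi hiM
    rcases hi.eq_or_lt with rfl | hi
    · exact fun p hp => (hfirst' p hp).le.trans (by linarith)
    · refine (hb 1 i le_rfl hi hiM 1).resolve_right fun hcon => ?_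
      obtain ⟨p, hp⟩ := exists_mem_proj (σ 1) (ρ 1 x0)
      have h1 := hcon p hp
      have h2 := hfirst' p hp
      have h3 := (σ 1).dist_initial_add_dist_terminal hp.1
      rw [hσl] at h3
      linarith
  have hEng : ∀ i, 1 ≤ i → i ≤ M → En i g := by
    intro i hi hiM
    rcases hiM.eq_or_lt with rfl | hiM
    · exact fun p hp => (hlast' p hp).le.trans (by linarith)
    · refine (hb i M hi hiM le_rfl g).resolve_left fun hcon => ?_
      obtain ⟨p, hp⟩ := exists_mem_proj (σ M) (ρ g x0)
      have h1 := hcon p hp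
      have h2 := hlast' p hp
      have h3 := (σ M).dist_initial_add_dist_terminal hp.1
      rw [hσl] at h3
      linarith
  have hR1 : (R3 : ℝ) ≤ 2 * ((R3 : ℝ) + 1) := by
    have := R3.cast_nonneg (α := ℝ)
    linarith
  have hStinv : St (m + 1) g⁻¹ := by
    by_contra hcon
    exact hgK (mem_exceptionalSet_of_crossing hSgen hb hc (by positivity) hR1 he hgn' hSt1 hEng
      (fun i hi him => (hb i (m + 1) hi (by omega) (by omega) _).resolve_left hcon) hm hm40 hmM
      hmR)
  have hEnsq : En (m + m) (g ^ 2) := by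
    by_contra hcon
    rw [sq] at hcon
    exact hgK (mem_exceptionalSet_of_crossing_mul_self hSgen hb hc (by positivity) hR1 he hgn'
      hSt1 hEng (fun i hiM him => (hb (m + m) i (by omega) (by omega) hiM _).resolve_right hcon)
      hm hm40 hmM hmR)
  refine ⟨hgn, fun i => h (m + i), ?_, ?_, ?_⟩
  · rw [hm, alignedSeq_iff _ _ _ _ (by omega)]
    refine ⟨?_, fun i hi him => ?_, ?_⟩
    · have := h4.alignedPair_point_left hδ hpos hBK (hSt1 (m + 1) (by omega) (by omega))
      rwa [hone] at this
    · have := hmid (m + i) (by omega) (by omega)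
      exact ⟨this.1.trans (by linarith), this.2.trans (by linarith)⟩
    · exact h4.alignedPair_point_right hδ hpos hBK (hEng (m + m) (by omega) (by omega))
  · exact h4.alignedPair_point_left hδ hpos hBK hStinv
  · subst hm
    exact h4.alignedPair_point_right hδ hpos hBK hEnsq

end AcylCount
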